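/- Let (P, L) be a linear system with |L| > ν₂(P,L). If p, q ∈ P are points with deg(p) = Δ(P,L) maximal and deg(q) = max{deg(x) : x ∈ P \ {p}}, and |L| ≤ deg(p) + deg(q) + ν₂(P,L) − 3, then τ(P,L) ≤ ν₂(P,L) − 1. -/

import Mathlib

open Finset

/-- The transversal number of a linear system. -/
noncomputable def tau {P : Type} [DecidableEq P] (L : Finset (Finset P)) : ℕ :=
  sInf {m | ∃ T : Finset P, (∀ l ∈ L, (l ∩ T).Nonempty) ∧ T.card = m}

/-- The 2-packing number of a linear system. -/
noncomputable def nu2 {P : Type} [DecidableEq P] (L : Finset (Finset P)) : ℕ :=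
  sSup {m | ∃ R : Finset (Finset P), R ⊆ L ∧
    (∀ x : P, (R.filter fun l => x ∈ l).card ≤ 2) ∧ R.card = m}

/-- The degree of a point: the number of lines containing it. -/
def deg {P : Type} [DecidableEq P] (L : Finset (Finset P)) (x : P) : ℕ :=
  (L.filter fun l => x ∈ l).card

theorem tau_le_of_cover {P : Type} [DecidableEq P] (L : Finset (Finset P)) (T : Finset P)
    (h : ∀ l ∈ L, ∃ x ∈ T, x ∈ l) : tau L ≤ T.card := by
  apply Nat.sInf_le
  refine ⟨T, fun l hl => ?_, rfl⟩
  obtain ⟨x, hx, hxl⟩ := h l hl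
  exact ⟨x, mem_inter.2 ⟨hxl, hx⟩⟩

theorem card_le_nu2 {P : Type} [DecidableEq P] (L R : Finset (Finset P)) (hR : R ⊆ L)
    (h : ∀ x : P, (R.filter fun l => x ∈ l).card ≤ 2) : R.card ≤ nu2 L := by
  apply le_csSup
  · refine ⟨L.card, ?_⟩
    rintro m ⟨R', hR', -, rfl⟩
    exact card_le_card hR'
  · exact ⟨R, hR, h, rfl⟩

/-- Theorem 2.1: if `|L| > ν₂`, `p` has maximum degree, `q` has maximum degree among the
remaining points, and `|L| ≤ deg p + deg q + ν₂ - 3`, then `τ ≤ ν₂ - 1`. -/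
theorem tau_le_nu2_sub_one {P : Type} [Fintype P] [DecidableEq P]
    (L : Finset (Finset P))
    (hLS : ∀ l ∈ L, ∀ l' ∈ L, l ≠ l' → (l ∩ l').card ≤ 1)
    (hcard : nu2 L < L.card)
    (p q : P) (hpq : p ≠ q)
    (hp : deg L p = (univ : Finset P).sup (deg L))
    (hq : deg L q = ((univ : Finset P).erase p).sup (deg L))
    (hL : L.card ≤ deg L p + deg L q + nu2 L - 3) :
    tau L ≤ nu2 L - 1 := by
  by_cases hemp : ∅ ∈ L
  · have : tau L = 0 := by
      unfold tau
      rw [Nat.sInf_eq_zero]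
      right
      ext m
      simp only [Set.mem_setOf_eq, Set.mem_empty_iff_false, iff_false]
      rintro ⟨T, hT, -⟩
      simpa using hT ∅ hemp
    omega
  have hne : ∀ l ∈ L, l.Nonempty := fun l hl =>
    nonempty_iff_ne_empty.2 (fun h => hemp (h ▸ hl))
  have huniq : ∀ l ∈ L, ∀ l' ∈ L, ∀ x y, x ≠ y → x ∈ l → x ∈ l' → y ∈ l → y ∈ l' → l = l' := by
    intro l hl l' hl' x y hxy h1 h2 h3 h4
    by_contra hll
    exact hxy (card_le_one.1 (hLS l hl l' hl' hll) x (mem_inter.2 ⟨h1, h2⟩) y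
      (mem_inter.2 ⟨h3, h4⟩))
  have hdp : 3 ≤ deg L p := by
    by_contra hlt
    have := card_le_nu2 L L (Subset.refl _) (fun x => by
      have : deg L x ≤ deg L p := by rw [hp]; exact le_sup (mem_univ x)
      unfold deg at *
      omega)
    omega
  have hex : ∀ l, ∃ x, l ∈ L → x ∈ l := fun l => by
    by_cases h : l ∈ L
    · obtain ⟨x, hx⟩ := hne l h
      exact ⟨x, fun _ => hx⟩
    · exact ⟨p, fun h' => absurd h' h⟩
  choose f hf using hex
  set Lp := L.filter fun l => p ∈ l with hLp
  set Lq := L.filter fun l => q ∈ l with hLq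
  set M := L.filter fun l => p ∉ l ∧ q ∉ l with hM
  have hcardM : M.card + (Lp ∪ Lq).card = L.card := by
    rw [← card_union_of_disjoint]
    · congr 1
      ext l
      simp only [hM, hLp, hLq, mem_union, mem_filter]
      tauto
    · rw [disjoint_left]
      intro l
      simp only [hM, hLp, hLq, mem_union, mem_filter]
      tauto
  have hui := card_union_add_card_inter Lp Lq
  have hdp' : deg L p = Lp.card := rfl
  have hdq' : deg L q = Lq.card := rfl
  have hint : (Lp ∩ Lq).card ≤ 1 := by
    rw [card_le_one]
    intro a ha b hb
    simp only [hLp, hLq, mem_inter, mem_filter] at ha hb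
    exact huniq a ha.1.1 b hb.1.1 p q hpq ha.1.2 hb.1.2 ha.2.2 hb.2.2
  by_cases hsmall : M.card + 3 ≤ nu2 L
  · refine (tau_le_of_cover L (insert p (insert q (M.image f))) ?_).trans ?_
    · intro l hl
      by_cases h1 : p ∈ l
      · exact ⟨p, by simp, h1⟩
      by_cases h2 : q ∈ l
      · exact ⟨q, by simp, h2⟩
      exact ⟨f l, by
        have : l ∈ M := mem_filter.2 ⟨hl, h1, h2⟩
        exact mem_insert_of_mem (mem_insert_of_mem (mem_image_of_mem f this)), hf l hl⟩
    · have h1 := card_insert_le p (insert q (M.image f))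
      have h2 := card_insert_le q (M.image f)
      have h3 : (M.image f).card ≤ M.card := card_image_le
      omega
  have hMc : M.card + 2 = nu2 L := by omega
  have hint1 : (Lp ∩ Lq).card = 1 := by omega
  obtain ⟨d, hd⟩ := card_eq_one.1 hint1
  have hdm : d ∈ Lp ∩ Lq := by rw [hd]; simp
  simp only [hLp, hLq, mem_inter, mem_filter] at hdm
  obtain ⟨⟨hdL, hpd⟩, -, hqd⟩ := hdm
  have hML : ∀ l ∈ M, l ∈ L ∧ p ∉ l ∧ q ∉ l := fun l hl => mem_filter.1 hl
  by_cases hmeet : ∃ a ∈ M, ∃ b ∈ M, a ≠ b ∧ ∃ x, x ∈ a ∧ x ∈ b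
  · obtain ⟨a, ha, b, hb, hab, x, hxa, hxb⟩ := hmeet
    refine (tau_le_of_cover L
      (insert p (insert q (insert x (((M.erase a).erase b).image f)))) ?_).trans ?_
    · intro l hl
      by_cases h1 : p ∈ l
      · exact ⟨p, by simp, h1⟩
      by_cases h2 : q ∈ l
      · exact ⟨q, by simp, h2⟩
      by_cases h3 : l = a
      · exact ⟨x, by simp, h3 ▸ hxa⟩
      by_cases h4 : l = b
      · exact ⟨x, by simp, h4 ▸ hxb⟩
      have : l ∈ (M.erase a).erase b :=
        mem_erase.2 ⟨h4, mem_erase.2 ⟨h3, mem_filter.2 ⟨hl, h1, h2⟩⟩⟩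
      exact ⟨f l, mem_insert_of_mem (mem_insert_of_mem (mem_insert_of_mem
        (mem_image_of_mem f this))), hf l hl⟩
    · have h1 := card_insert_le p (insert q (insert x (((M.erase a).erase b).image f)))
      have h2 := card_insert_le q (insert x (((M.erase a).erase b).image f))
      have h3 := card_insert_le x (((M.erase a).erase b).image f)
      have h4 : (((M.erase a).erase b).image f).card ≤ ((M.erase a).erase b).card :=
        card_image_le
      have h5 := card_erase_add_one ha
      have h6 := card_erase_add_one (mem_erase.2 ⟨hab.symm, hb⟩)
      omega
  push Not at hmeet
  have hdis : ∀ a ∈ M, ∀ b ∈ M, ∀ x, x ∈ a → x ∈ b → a = b := by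
    intro a ha b hb x hxa hxb
    by_contra hab
    exact hmeet a ha b hb hab x hxa hxb
  -- a line through `p` other than the line `pq`
  obtain ⟨b, hbp, hbd⟩ : ∃ b ∈ Lp, b ≠ d := by
    apply exists_mem_ne
    omega
  obtain ⟨hbL, hpb⟩ := mem_filter.1 hbp
  have hqb : q ∉ b := fun h => hbd (huniq b hbL d hdL p q hpq hpb hpd h hqd)
  have hkey : ∀ c ∈ L, q ∈ c → c ≠ d → ∃ l ∈ M, ∃ x, x ∈ b ∧ x ∈ c ∧ x ∈ l := by
    intro c hcL hqc hcd
    have hpc : p ∉ c := fun h => hcd (huniq c hcL d hdL p q hpq h hpd hqc hqd)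
    by_contra hno
    push Not at hno
    have hbc : b ≠ c := fun h => hqb (h ▸ hqc)
    have hbM : b ∉ M := fun h => (hML b h).2.1 hpb
    have hcM : c ∉ M := fun h => (hML c h).2.2 hqc
    have hdM : d ∉ M := fun h => (hML d h).2.1 hpd
    have hcar : (insert b (insert c (insert d M))).card = M.card + 3 := by
      rw [card_insert_of_notMem, card_insert_of_notMem, card_insert_of_notMem hdM]
      · simp [hcd, hcM]
      · simp [hbc, hbd, hbM]
    have hle := card_le_nu2 L (insert b (insert c (insert d M))) (by
      intro l hl
      simp only [mem_insert] at hl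
      rcases hl with rfl | rfl | rfl | hl
      · exact hbL
      · exact hcL
      · exact hdL
      · exact (hML l hl).1) (by
      intro x
      by_contra hgt
      obtain ⟨u, v, w, hu, hv, hw, huv, huw, hvw⟩ := two_lt_card_iff.1 (not_le.1 hgt)
      have hbdx : x ∈ b → x ∈ d → x = p := fun h1 h2 => by
        by_contra hxp
        exact hbd (huniq b hbL d hdL x p hxp h1 h2 hpb hpd)
      have hcdx : x ∈ c → x ∈ d → x = q := fun h1 h2 => by
        by_contra hxp
        exact hcd (huniq c hcL d hdL x q hxp h1 h2 hqc hqd)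
      have hno' : ∀ l ∈ M, x ∈ b → x ∈ c → x ∉ l := fun l hl => hno l hl x
      have hdis' : ∀ a ∈ M, ∀ b ∈ M, x ∈ a → x ∈ b → a = b := fun a ha b hb => hdis a ha b hb x
      simp only [mem_filter, mem_insert] at hu hv hw
      clear hno hdis hmeet huniq hLS hf hne
      grind)
    omega
  have hex2 : ∀ l, ∃ x, l ∈ L → x ∈ l ∧ ((∃ y, y ∈ b ∧ y ∈ l) → x ∈ b) := fun l => by
    by_cases h : ∃ y, y ∈ b ∧ y ∈ l
    · obtain ⟨y, hy, hyl⟩ := h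
      exact ⟨y, fun _ => ⟨hyl, fun _ => hy⟩⟩
    · exact ⟨f l, fun hl => ⟨hf l hl, fun h' => absurd h' h⟩⟩
  choose g hg using hex2
  refine (tau_le_of_cover L (insert p (M.image g)) ?_).trans ?_
  · intro l hl
    by_cases h1 : p ∈ l
    · exact ⟨p, by simp, h1⟩
    by_cases h2 : q ∈ l
    · obtain ⟨m, hm, x, hxb, hxl, hxm⟩ := hkey l hl h2 (fun h => h1 (h ▸ hpd))
      obtain ⟨hgm, hgb⟩ := hg m (hML m hm).1
      have hgb := hgb ⟨x, hxb, hxm⟩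
      refine ⟨g m, mem_insert_of_mem (mem_image_of_mem g hm), ?_⟩
      have : g m = x := by
        by_contra hgx
        have := huniq b hbL m (hML m hm).1 (g m) x hgx hgb hgm hxb hxm
        exact (hML m hm).2.1 (this ▸ hpb)
      rw [this]
      exact hxl
    · exact ⟨g l, mem_insert_of_mem (mem_image_of_mem g (mem_filter.2 ⟨hl, h1, h2⟩)),
        (hg l hl).1⟩
  · have h1 := card_insert_le p (M.image g)
    have h3 : (M.image g).card ≤ M.card := card_image_le
    omega
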